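/- arXiv:1310.3552 — 2 statements merged into one kernel-verified Lean document; each statement's English description precedes it below -/
import Mathlib

section
/- Let p_1,…,p_r be distinct points of K^n (n ≥ 1), let m_1,…,m_r be positive integers, and let I = ⋂_{i=1}^r I(p_i)^{m_i}. Then H^≤_I(t) = C(t+n,n) − Σ_{i=1}^r C(m_i+n−1,n) for all t ≥ m_1+⋯+m_r−1. Moreover, if all the points lie on a common affine line, then H^≤_I(t) > C(t+n,n) − Σ_{i=1}^r C(m_i+n−1,n) for all t with 0 ≤ t < m_1+⋯+m_r−1. -/
open MvPolynomial Filter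
open scoped Classical

noncomputable section

/-- The (maximal) ideal of polynomials vanishing at the point `p` of affine `n`-space. -/
def pointIdeal {n : ℕ} (K : Type*) [Field K] (p : Fin n → K) :
    Ideal (MvPolynomial (Fin n) K) :=
  RingHom.ker (MvPolynomial.eval p)

/-- The homogeneous ideal generated by the forms vanishing at (a representative of) a point of
projective space. -/
def projPointIdeal {N : ℕ} (K : Type*) [Field K] (p : Fin N → K) :
    Ideal (MvPolynomial (Fin N) K) :=
  Ideal.span { f | (∃ d, f.IsHomogeneous d) ∧ MvPolynomial.eval p f = 0 }

/-- `α(I)`: the least degree of a nonzero element of `I`. -/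
def alphaDeg {σ K : Type*} [Field K] (I : Ideal (MvPolynomial σ K)) : ℕ :=
  sInf { d | ∃ f ∈ I, f ≠ 0 ∧ f.totalDegree = d }

/-- `H^≤_I(t) = dim_K I_{≤ t}`. -/
def hilbLe {n : ℕ} (K : Type*) [Field K] (I : Ideal (MvPolynomial (Fin n) K)) (t : ℕ) : ℕ :=
  Module.finrank K
    ↥(Submodule.restrictScalars K I ⊓ MvPolynomial.restrictTotalDegree (Fin n) K t)

/-- `H_{R/I}(t) = dim_K R_t/I_t = dim_K R_t - dim_K I_t`. -/
def hilbProj {N : ℕ} (K : Type*) [Field K] (I : Ideal (MvPolynomial (Fin N) K)) (t : ℕ) : ℕ :=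
  Module.finrank K ↥(MvPolynomial.homogeneousSubmodule (Fin N) K t) -
    Module.finrank K
      ↥(Submodule.restrictScalars K I ⊓ MvPolynomial.homogeneousSubmodule (Fin N) K t)


open Finset in
theorem ncard_finsupp_degree_lt (n k : ℕ) (hn : 1 ≤ n) :
    {d : Fin n →₀ ℕ | d.degree < k}.ncard = (k + n - 1).choose n := by
  have hset : {d : Fin n →₀ ℕ | d.degree < k} =
      ((range k).biUnion fun e => (univ : Finset (Fin n)).finsuppAntidiag e :) := by
    ext d
    simp [mem_finsuppAntidiag, Finsupp.degree_eq_sum]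
  rw [hset, Set.ncard_coe_finset, card_biUnion]
  · simp only [card_finsuppAntidiag_nat_eq_choose, card_univ, Fintype.card_fin]
    obtain ⟨a, rfl⟩ : ∃ a, n = a + 1 := ⟨n - 1, by omega⟩
    rcases k with _ | b
    · simp
    · have := Nat.sum_range_add_choose b a
      rw [show b + 1 + (a + 1) - 1 = b + a + 1 by omega, ← this]
      refine sum_congr rfl fun e _ => ?_
      rw [show a + 1 + e - 1 = e + a by omega, ← Nat.choose_symm_add]
  · intro a _ b _ hab
    rw [Function.onFun, disjoint_left]
    intro d ha hb
    simp only [mem_finsuppAntidiag] at ha hb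
    exact hab (ha.1.symm.trans hb.1)

theorem finrank_restrictTotalDegree (K : Type*) [Field K] (n t : ℕ) (hn : 1 ≤ n) :
    Module.finrank K (restrictTotalDegree (Fin n) K t) = (t + n).choose n := by
  rw [restrictTotalDegree,
    Module.finrank_eq_nat_card_basis (basisRestrictSupport K _), Nat.card_coe_set_eq]
  have := ncard_finsupp_degree_lt n (t + 1) hn
  rw [show t + 1 + n - 1 = t + n by omega] at this
  rw [← this]
  congr 1
  ext d
  rw [Set.mem_ofPred_eq, Set.mem_ofPred_eq, Nat.lt_succ_iff]
  rfl

/-- The substitution `x ↦ x + p`. -/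
def translatePoly {n : ℕ} {K : Type*} [Field K] (p : Fin n → K) :
    MvPolynomial (Fin n) K ≃ₐ[K] MvPolynomial (Fin n) K :=
  AlgEquiv.ofAlgHom (aeval fun i => X i + C (p i)) (aeval fun i => X i - C (p i))
    (by ext i; simp [← algebraMap_eq]) (by ext i; simp [← algebraMap_eq])

section Translate

variable {n : ℕ} {K : Type*} [Field K]

theorem translatePoly_apply (p : Fin n → K) (f : MvPolynomial (Fin n) K) :
    translatePoly p f = aeval (fun i => X i + C (p i)) f := rfl

theorem translatePoly_symm_apply (p : Fin n → K) (f : MvPolynomial (Fin n) K) :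
    (translatePoly p).symm f = aeval (fun i => X i - C (p i)) f := rfl

theorem constantCoeff_translatePoly (p : Fin n → K) (f : MvPolynomial (Fin n) K) :
    constantCoeff (translatePoly p f) = eval p f := by
  have : (aeval (0 : Fin n → K)).comp (translatePoly p : MvPolynomial (Fin n) K →ₐ[K] _) =
      aeval p := by
    ext i
    simp [translatePoly_apply]
  simpa [aeval_eq_eval, constantCoeff_eq, ← eval_zero] using DFunLike.congr_fun this f

theorem mem_pointIdeal_iff (p : Fin n → K) (f : MvPolynomial (Fin n) K) :
    f ∈ pointIdeal K p ↔ eval p f = 0 := Iff.rfl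

theorem translatePoly_mem_map_iff (p : Fin n → K) (J : Ideal (MvPolynomial (Fin n) K))
    (f : MvPolynomial (Fin n) K) : translatePoly p f ∈ J.map (translatePoly p) ↔ f ∈ J := by
  rw [Ideal.mem_map_iff_of_surjective _ (translatePoly p).surjective]
  exact ⟨fun ⟨x, hx, e⟩ => (translatePoly p).injective e ▸ hx, fun h => ⟨f, h, rfl⟩⟩

theorem map_translatePoly_pointIdeal (p : Fin n → K) :
    (pointIdeal K p).map (translatePoly p) = idealOfVars (Fin n) K := by
  ext g
  obtain ⟨f, rfl⟩ := (translatePoly p).surjective g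
  have h := mem_pow_idealOfVars_iff' 1 (translatePoly p f)
  rw [pow_one] at h
  rw [translatePoly_mem_map_iff, mem_pointIdeal_iff, ← constantCoeff_translatePoly, h]
  simp [Finsupp.degree_eq_zero_iff, constantCoeff_eq]

theorem mem_pointIdeal_pow_iff (p : Fin n → K) (k : ℕ) (f : MvPolynomial (Fin n) K) :
    f ∈ pointIdeal K p ^ k ↔
      ∀ d : Fin n →₀ ℕ, d.degree < k → (translatePoly p f).coeff d = 0 := by
  rw [← mem_pow_idealOfVars_iff', ← map_translatePoly_pointIdeal p, ← Ideal.map_pow,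
    translatePoly_mem_map_iff]

theorem totalDegree_aeval_le_of_totalDegree_le_one (φ : Fin n → MvPolynomial (Fin n) K)
    (hφ : ∀ i, (φ i).totalDegree ≤ 1) (f : MvPolynomial (Fin n) K) :
    (aeval φ f).totalDegree ≤ f.totalDegree := by
  rw [aeval_def, eval₂_eq]
  refine totalDegree_finsetSum_le fun d hd => ?_
  refine (totalDegree_mul _ _).trans ?_
  rw [algebraMap_eq, totalDegree_C, zero_add]
  refine (totalDegree_finsetProd _ _).trans (le_trans ?_ (le_totalDegree hd))
  refine Finset.sum_le_sum fun i _ => (totalDegree_pow _ _).trans ?_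
  simpa using Nat.mul_le_mul_left (d i) (hφ i)

theorem exists_totalDegree_le_sub_mem_pow_succ (p : Fin n → K) (k : ℕ)
    {f : MvPolynomial (Fin n) K} (hf : f ∈ pointIdeal K p ^ k) :
    ∃ F ∈ pointIdeal K p ^ k, F.totalDegree ≤ k ∧ f - F ∈ pointIdeal K p ^ (k + 1) := by
  rw [mem_pointIdeal_pow_iff] at hf
  refine ⟨(translatePoly p).symm (homogeneousComponent k (translatePoly p f)), ?_, ?_, ?_⟩
  · rw [mem_pointIdeal_pow_iff]
    intro d hd
    rw [AlgEquiv.apply_symm_apply, coeff_homogeneousComponent, if_neg hd.ne]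
  · rw [translatePoly_symm_apply]
    refine (totalDegree_aeval_le_of_totalDegree_le_one _ (fun i => ?_) _).trans ?_
    · exact (totalDegree_sub_C_le _ _).trans (totalDegree_X i).le
    · exact (homogeneousComponent_isHomogeneous k _).totalDegree_le
  · rw [mem_pointIdeal_pow_iff]
    intro d hd
    rw [map_sub, AlgEquiv.apply_symm_apply, coeff_sub, coeff_homogeneousComponent]
    split_ifs with h
    · simp
    · rw [hf d (by omega), sub_zero]

end Translate

section Points

variable {n r : ℕ} {K : Type*} [Field K]

theorem exists_mem_pow_eval_eq_one (p : Fin r → Fin n → K) (hp : Function.Injective p)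
    (m : Fin r → ℕ) (i : Fin r) :
    ∃ L : MvPolynomial (Fin n) K, L.totalDegree ≤ ∑ j ∈ Finset.univ.erase i, m j ∧
      eval (p i) L = 1 ∧ ∀ j ≠ i, L ∈ pointIdeal K (p j) ^ m j := by
  have hl : ∀ j, ∃ l : MvPolynomial (Fin n) K, j ≠ i →
      l.totalDegree ≤ 1 ∧ eval (p i) l = 1 ∧ eval (p j) l = 0 := by
    intro j
    by_cases hj : j = i
    · exact ⟨0, fun h => (h hj).elim⟩
    obtain ⟨a, ha⟩ := Function.ne_iff.mp (hp.ne hj)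
    refine ⟨C (p i a - p j a)⁻¹ * (X a - C (p j a)), fun _ => ⟨?_, ?_, ?_⟩⟩
    · refine (totalDegree_mul _ _).trans ?_
      rw [totalDegree_C, zero_add]
      exact (totalDegree_sub_C_le _ _).trans (totalDegree_X a).le
    · simpa using inv_mul_cancel₀ (sub_ne_zero.mpr ha.symm)
    · simp
  choose l hl using hl
  refine ⟨∏ j ∈ Finset.univ.erase i, l j ^ m j, ?_, ?_, ?_⟩
  · refine (totalDegree_finsetProd _ _).trans (Finset.sum_le_sum fun j hj => ?_)
    refine (totalDegree_pow _ _).trans ?_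
    simpa using Nat.mul_le_mul_left (m j) (hl j (Finset.ne_of_mem_erase hj)).1
  · rw [map_prod]
    refine Finset.prod_eq_one fun j hj => ?_
    rw [map_pow, (hl j (Finset.ne_of_mem_erase hj)).2.1, one_pow]
  · intro j hj
    refine Ideal.mem_of_dvd _ (Finset.dvd_prod_of_mem _ (by simpa using hj)) ?_
    exact Ideal.pow_mem_pow ((mem_pointIdeal_iff _ _).mpr (hl j hj).2.2) _

theorem exists_totalDegree_le_sub_mem (p : Fin r → Fin n → K) (hp : Function.Injective p)
    (m : Fin r → ℕ) (i : Fin r) (e : ℕ) : ∀ (k : ℕ), k + e = m i →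
    ∀ f ∈ pointIdeal K (p i) ^ k, ∃ h : MvPolynomial (Fin n) K,
      h.totalDegree ≤ ∑ j, m j - 1 ∧ f - h ∈ pointIdeal K (p i) ^ m i ∧
      ∀ j ≠ i, h ∈ pointIdeal K (p j) ^ m j := by
  induction e with
  | zero =>
    rintro k hk f hf
    rw [add_zero] at hk
    exact ⟨0, by simp, by simpa [← hk] using hf, fun _ _ => zero_mem _⟩
  | succ e ih =>
    intro k hk f hf
    obtain ⟨L, hLdeg, hLi, hLj⟩ := exists_mem_pow_eval_eq_one p hp m i
    obtain ⟨F, hF, hFdeg, hfF⟩ := exists_totalDegree_le_sub_mem_pow_succ (p i) k hf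
    have hL : 1 - L ∈ pointIdeal K (p i) := by
      rw [mem_pointIdeal_iff]
      simp [hLi]
    have hmem : f - F * L ∈ pointIdeal K (p i) ^ (k + 1) := by
      rw [show f - F * L = (f - F) + F * (1 - L) by ring]
      exact add_mem hfF (pow_succ (pointIdeal K (p i)) k ▸ Ideal.mul_mem_mul hF hL)
    obtain ⟨h, hdeg, hi, hj⟩ := ih (k + 1) (by omega) _ hmem
    refine ⟨F * L + h, ?_, by rwa [← sub_sub], fun j hne => ?_⟩
    · refine (totalDegree_add _ _).trans (max_le ((totalDegree_mul _ _).trans ?_) hdeg)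
      have := Finset.add_sum_erase Finset.univ m (Finset.mem_univ i)
      omega
    · exact add_mem (Ideal.mul_mem_left _ _ (hLj j hne)) (hj j hne)

/-- The Taylor coefficients of order less than `m i` at the point `p i`, for all `i`. -/
def taylorCoeffs (p : Fin r → Fin n → K) (m : Fin r → ℕ) :
    MvPolynomial (Fin n) K →ₗ[K]
      ((Σ i, {d : Fin n →₀ ℕ | d.degree < m i}) → K) :=
  LinearMap.pi fun x => lcoeff K x.2.1 ∘ₗ (translatePoly (p x.1)).toLinearMap

theorem taylorCoeffs_apply (p : Fin r → Fin n → K) (m : Fin r → ℕ)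
    (f : MvPolynomial (Fin n) K) (x : Σ i, {d : Fin n →₀ ℕ | d.degree < m i}) :
    taylorCoeffs p m f x = (translatePoly (p x.1) f).coeff x.2.1 := rfl

theorem ker_taylorCoeffs (p : Fin r → Fin n → K) (m : Fin r → ℕ) :
    LinearMap.ker (taylorCoeffs p m) =
      (⨅ i, pointIdeal K (p i) ^ m i : Ideal _).restrictScalars K := by
  ext f
  simp only [LinearMap.mem_ker, Submodule.restrictScalars_mem, Ideal.mem_iInf,
    mem_pointIdeal_pow_iff, funext_iff, taylorCoeffs_apply]
  exact ⟨fun h i d hd => h ⟨i, d, hd⟩, fun h x => h x.1 x.2.1 x.2.2⟩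

instance (k : ℕ) : Finite {d : Fin n →₀ ℕ | d.degree < k} :=
  Finsupp.finite_of_degree_lt k

theorem surjective_taylorCoeffs_domRestrict (p : Fin r → Fin n → K)
    (hp : Function.Injective p) (m : Fin r → ℕ) (t : ℕ) (ht : ∑ i, m i - 1 ≤ t) :
    Function.Surjective ((taylorCoeffs p m).domRestrict (restrictTotalDegree (Fin n) K t)) := by
  have := Fintype.ofFinite (Σ i, {d : Fin n →₀ ℕ | d.degree < m i})
  rw [← LinearMap.range_eq_top, eq_top_iff]
  rintro y -
  rw [pi_eq_sum_univ y]
  refine Submodule.sum_mem _ fun x _ => Submodule.smul_mem _ _ ?_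
  obtain ⟨h, hdeg, hi, hj⟩ := exists_totalDegree_le_sub_mem p hp m x.1 (m x.1) 0 (by simp)
    ((translatePoly (p x.1)).symm (monomial x.2.1 1)) (by simp)
  refine ⟨⟨h, (mem_restrictTotalDegree _ _ _).mpr (hdeg.trans ht)⟩, ?_⟩
  funext ⟨j, d⟩
  rw [LinearMap.domRestrict_apply, taylorCoeffs_apply]
  obtain ⟨i, c⟩ := x
  by_cases hji : j = i
  · subst hji
    have := (mem_pointIdeal_pow_iff _ _ _).mp hi d.1 d.2
    rw [map_sub, AlgEquiv.apply_symm_apply, coeff_sub, coeff_monomial, sub_eq_zero] at this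
    rw [← this]
    simp [Subtype.ext_iff]
  · rw [(mem_pointIdeal_pow_iff _ _ _).mp (hj j hji) d.1 d.2, if_neg]
    rintro ⟨⟩
    exact hji rfl

theorem finrank_taylorCoeffs_codomain (hn : 1 ≤ n) (m : Fin r → ℕ) :
    Module.finrank K ((Σ i, {d : Fin n →₀ ℕ | d.degree < m i}) → K) =
      ∑ i, (m i + n - 1).choose n := by
  have := fun i => Fintype.ofFinite {d : Fin n →₀ ℕ | d.degree < m i}
  rw [Module.finrank_fintype_fun_eq_card, Fintype.card_sigma]
  refine Finset.sum_congr rfl fun i _ => ?_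
  rw [← ncard_finsupp_degree_lt n (m i) hn, ← Nat.card_coe_set_eq, Nat.card_eq_fintype_card]

theorem finrank_range_add_hilbLe (hn : 1 ≤ n) (p : Fin r → Fin n → K) (m : Fin r → ℕ) (t : ℕ) :
    Module.finrank K (LinearMap.range
      ((taylorCoeffs p m).domRestrict (restrictTotalDegree (Fin n) K t))) +
      hilbLe K (⨅ i, pointIdeal K (p i) ^ m i) t = (t + n).choose n := by
  rw [← finrank_restrictTotalDegree K n t hn, ← LinearMap.finrank_range_add_finrank_ker
    ((taylorCoeffs p m).domRestrict (restrictTotalDegree (Fin n) K t)), hilbLe,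
    ← ker_taylorCoeffs, LinearMap.ker_domRestrict, inf_comm, ← Submodule.map_comap_subtype]
  exact congrArg _ (Submodule.finrank_map_subtype_eq _ _)

/-- Restriction of polynomials to the parametrized line `u ↦ v + u w`. -/
def restrictLine (v w : Fin n → K) : MvPolynomial (Fin n) K →ₐ[K] Polynomial K :=
  aeval fun j => Polynomial.C (v j) + Polynomial.C (w j) * Polynomial.X

theorem natDegree_restrictLine_le (v w : Fin n → K) (f : MvPolynomial (Fin n) K) :
    (restrictLine v w f).natDegree ≤ f.totalDegree := by
  rw [restrictLine, aeval_def, eval₂_eq]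
  refine Polynomial.natDegree_sum_le_of_forall_le _ _ fun d hd => ?_
  rw [Polynomial.algebraMap_eq]
  refine (Polynomial.natDegree_C_mul_le _ _).trans ?_
  refine (Polynomial.natDegree_prod_le _ _).trans (le_trans ?_ (le_totalDegree hd))
  refine Finset.sum_le_sum fun i _ => Polynomial.natDegree_pow_le.trans ?_
  have : (Polynomial.C (v i) + Polynomial.C (w i) * Polynomial.X).natDegree ≤ 1 := by
    compute_degree
  simpa using Nat.mul_le_mul_left (d i) this

theorem eval_restrictLine (v w : Fin n → K) (c : K) (f : MvPolynomial (Fin n) K) :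
    (restrictLine v w f).eval c = eval (v + c • w) f := by
  rw [restrictLine, aeval_def, eval₂_eq, Polynomial.eval_finsetSum, eval_eq]
  simp [Polynomial.eval_prod, mul_comm c]

theorem pow_dvd_restrictLine (v w : Fin n → K) (c : K) (k : ℕ) {f : MvPolynomial (Fin n) K}
    (hf : f ∈ pointIdeal K (v + c • w) ^ k) :
    (Polynomial.X - Polynomial.C c) ^ k ∣ restrictLine v w f := by
  rw [← Ideal.mem_span_singleton, ← Ideal.span_singleton_pow, ← Ideal.mem_comap]
  refine Ideal.le_comap_pow _ _ (Ideal.pow_right_mono (fun g hg => ?_) k hf)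
  rw [Ideal.mem_comap, Ideal.mem_span_singleton, Polynomial.dvd_iff_isRoot, Polynomial.IsRoot,
    eval_restrictLine]
  exact hg

theorem not_surjective_taylorCoeffs_domRestrict (p : Fin r → Fin n → K)
    (hp : Function.Injective p) (m : Fin r → ℕ) (v w : Fin n → K) (hw : w ≠ 0)
    (hline : ∀ i, ∃ c : K, p i = v + c • w) (t : ℕ) (ht : t < ∑ i, m i - 1) :
    ¬ Function.Surjective
      ((taylorCoeffs p m).domRestrict (restrictTotalDegree (Fin n) K t)) := by
  intro hsurj
  choose c hc using hline
  have hcinj : Function.Injective c := fun i j h => hp (by rw [hc, hc, h])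
  obtain ⟨a, ha⟩ := Function.ne_iff.mp hw
  set G : MvPolynomial (Fin n) K := (C (w a)⁻¹ * (X a - C (v a))) ^ (∑ i, m i - 1) with hG
  have hGline : restrictLine v w G = Polynomial.X ^ (∑ i, m i - 1) := by
    have : Polynomial.C (w a)⁻¹ * (Polynomial.C (w a) * Polynomial.X) = Polynomial.X := by
      rw [← mul_assoc, ← Polynomial.C_mul, inv_mul_cancel₀ ha, Polynomial.C_1, one_mul]
    simp [hG, restrictLine, this, ← algebraMap_eq]
  obtain ⟨⟨h, hh⟩, hhG⟩ := hsurj (taylorCoeffs p m G)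
  rw [mem_restrictTotalDegree] at hh
  have hmem : G - h ∈ LinearMap.ker (taylorCoeffs p m) := by
    rw [LinearMap.mem_ker, map_sub, sub_eq_zero]
    exact hhG.symm
  rw [ker_taylorCoeffs, Submodule.restrictScalars_mem, Ideal.mem_iInf] at hmem
  have hdvd : ∏ i, (Polynomial.X - Polynomial.C (c i)) ^ m i ∣ restrictLine v w (G - h) := by
    refine Fintype.prod_dvd_of_coprime (fun i j hij => ?_) fun i => ?_
    · exact (Polynomial.pairwise_coprime_X_sub_C hcinj hij).pow
    · exact pow_dvd_restrictLine v w (c i) (m i) (hc i ▸ hmem i)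
  have hlt : (restrictLine v w h).natDegree <
      (Polynomial.X ^ (∑ i, m i - 1) : Polynomial K).natDegree := by
    rw [Polynomial.natDegree_X_pow]
    exact ((natDegree_restrictLine_le v w h).trans hh).trans_lt ht
  have hdeg : (restrictLine v w (G - h)).natDegree = ∑ i, m i - 1 := by
    rw [map_sub, hGline, Polynomial.natDegree_sub_eq_left_of_natDegree_lt hlt,
      Polynomial.natDegree_X_pow]
  have hle := Polynomial.natDegree_le_of_dvd hdvd (by
    intro h0
    rw [h0, Polynomial.natDegree_zero] at hdeg
    omega)
  rw [hdeg, Polynomial.natDegree_prod_of_monic _ _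
    fun i _ => (Polynomial.monic_X_sub_C _).pow _] at hle
  simp only [Polynomial.natDegree_pow, Polynomial.natDegree_X_sub_C, mul_one] at hle
  omega

end Points

/-- for distinct points `p_i ∈ K^n` and `m_i ≥ 1`, with
`I = ⋂ I(p_i)^{m_i}`, equality `H^≤_I(t) = C(t+n,n) − Σ_i C(m_i+n−1,n)` holds for all
`t ≥ m_1+⋯+m_r−1`; and if the points lie on a common affine line then the inequality is
strict for all `0 ≤ t < m_1+⋯+m_r−1`. -/
theorem stmt_9 {K : Type*} [Field K] [IsAlgClosed K]
    (n r : ℕ) (hn : 1 ≤ n)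
    (p : Fin r → (Fin n → K)) (hp : Function.Injective p)
    (m : Fin r → ℕ) (hm : ∀ i, 1 ≤ m i)
    (I : Ideal (MvPolynomial (Fin n) K)) (hI : I = ⨅ i, (pointIdeal K (p i)) ^ (m i)) :
    (∀ t : ℕ, (∑ i : Fin r, m i) - 1 ≤ t →
      (hilbLe K I t : ℤ)
        = (Nat.choose (t + n) n : ℤ) - ∑ i : Fin r, (Nat.choose (m i + n - 1) n : ℤ)) ∧
    ((∃ v w : Fin n → K, w ≠ 0 ∧ ∀ i, ∃ c : K, p i = v + c • w) →
      ∀ t : ℕ, t < (∑ i : Fin r, m i) - 1 →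
        (Nat.choose (t + n) n : ℤ) - ∑ i : Fin r, (Nat.choose (m i + n - 1) n : ℤ)
          < (hilbLe K I t : ℤ)) := by
  subst hI
  have hcod := finrank_taylorCoeffs_codomain (K := K) hn m
  refine ⟨fun t ht => ?_, fun ⟨v, w, hw, hline⟩ t ht => ?_⟩
  · have h := finrank_range_add_hilbLe hn p m t
    rw [LinearMap.range_eq_top.mpr (surjective_taylorCoeffs_domRestrict p hp m t ht),
      finrank_top, hcod] at h
    rw [← h]
    push_cast
    ring
  · have h := finrank_range_add_hilbLe hn p m t
    have hlt := Submodule.finrank_lt (mt LinearMap.range_eq_top.mp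
      (not_surjective_taylorCoeffs_domRestrict p hp m v w hw hline t ht))
    rw [hcod] at hlt
    rw [← h, ← Nat.cast_sum]
    push_cast
    have : ((_ : ℕ) : ℤ) < _ := Nat.cast_lt.mpr hlt
    push_cast at this
    linarith
end
end

section
/- Let p_1,…,p_s ∈ P^n be distinct points and let I = ⋂_i I(p_i) be their radical ideal. Fix an integer m ≥ 1 and assume that I^{((m−1+n)t)} ⊆ (I^{(m)})^t for every integer t ≥ 1. Then α(I^{(m)})/(n+m−1) ≤ γ(I), where γ(I) = lim_{k→∞} α(I^{(k)})/k (which exists). -/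
open MvPolynomial Filter
open scoped Classical

noncomputable section

section AlphaDeg

variable {σ K : Type*} [Field K]

lemma alphaDeg_le_totalDegree {I : Ideal (MvPolynomial σ K)} {f : MvPolynomial σ K}
    (hf : f ∈ I) (hf0 : f ≠ 0) : alphaDeg I ≤ f.totalDegree :=
  Nat.sInf_le ⟨f, hf, hf0, rfl⟩

lemma exists_totalDegree_eq_alphaDeg {I : Ideal (MvPolynomial σ K)} (hI : I ≠ ⊥) :
    ∃ f ∈ I, f ≠ 0 ∧ f.totalDegree = alphaDeg I := by
  obtain ⟨f, hf, hf0⟩ := Submodule.exists_mem_ne_zero_of_ne_bot hI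
  exact Nat.sInf_mem (s := {d | ∃ f ∈ I, f ≠ 0 ∧ f.totalDegree = d}) ⟨_, f, hf, hf0, rfl⟩

@[simp]
lemma alphaDeg_bot : alphaDeg (⊥ : Ideal (MvPolynomial σ K)) = 0 := by
  simp [alphaDeg]

lemma alphaDeg_anti {I J : Ideal (MvPolynomial σ K)} (hI : I ≠ ⊥) (hIJ : I ≤ J) :
    alphaDeg J ≤ alphaDeg I := by
  obtain ⟨f, hf, hf0, hd⟩ := exists_totalDegree_eq_alphaDeg hI
  exact hd ▸ alphaDeg_le_totalDegree (hIJ hf) hf0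

lemma alphaDeg_mul_le {I J : Ideal (MvPolynomial σ K)} (hI : I ≠ ⊥) (hJ : J ≠ ⊥) :
    alphaDeg (I * J) ≤ alphaDeg I + alphaDeg J := by
  obtain ⟨f, hf, hf0, hfd⟩ := exists_totalDegree_eq_alphaDeg hI
  obtain ⟨g, hg, hg0, hgd⟩ := exists_totalDegree_eq_alphaDeg hJ
  rw [← hfd, ← hgd]
  exact (alphaDeg_le_totalDegree (Ideal.mul_mem_mul hf hg) (mul_ne_zero hf0 hg0)).trans
    (totalDegree_mul f g)

attribute [local instance] MvPolynomial.gradedAlgebra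

lemma Ideal.IsHomogeneous.pow_of_homogeneousSubmodule {I : Ideal (MvPolynomial σ K)}
    (hI : I.IsHomogeneous (homogeneousSubmodule σ K)) (k : ℕ) :
    (I ^ k).IsHomogeneous (homogeneousSubmodule σ K) := by
  induction k with
  | zero => rw [pow_zero, Ideal.one_eq_top]; exact Ideal.IsHomogeneous.top _
  | succ k ih => rw [pow_succ]; exact ih.mul hI

lemma Ideal.IsHomogeneous.le_idealOfVars_pow_alphaDeg {I : Ideal (MvPolynomial σ K)}
    (hI : I.IsHomogeneous (homogeneousSubmodule σ K)) :
    I ≤ idealOfVars σ K ^ alphaDeg I := by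
  intro f hf
  rw [mem_pow_idealOfVars_iff]
  intro x hx
  have hne : homogeneousComponent x.degree f ≠ 0 := by
    intro h
    have hc := coeff_homogeneousComponent x.degree f x
    rw [h, if_pos rfl, coeff_zero] at hc
    exact mem_support_iff.mp hx hc.symm
  have h := alphaDeg_le_totalDegree (homogeneousComponent_mem_of_mem hI hf x.degree) hne
  rwa [(homogeneousComponent_isHomogeneous x.degree f).totalDegree hne] at h

lemma le_totalDegree_of_mem_idealOfVars_pow {f : MvPolynomial σ K} {d : ℕ}
    (hf : f ∈ idealOfVars σ K ^ d) (hf0 : f ≠ 0) : d ≤ f.totalDegree := by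
  obtain ⟨x, hx⟩ := support_nonempty.mpr hf0
  exact ((mem_pow_idealOfVars_iff d f).mp hf x hx).trans (le_totalDegree hx)

/-- For a homogeneous ideal `I`, every nonzero ideal inside `I ^ t` starts in degree at least
`α(I) * t`. -/
lemma Ideal.IsHomogeneous.alphaDeg_mul_le_of_le_pow {I J : Ideal (MvPolynomial σ K)}
    (hI : I.IsHomogeneous (homogeneousSubmodule σ K)) {t : ℕ} (hJ : J ≠ ⊥) (hJI : J ≤ I ^ t) :
    alphaDeg I * t ≤ alphaDeg J := by
  obtain ⟨f, hf, hf0, hd⟩ := exists_totalDegree_eq_alphaDeg hJ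
  rw [← hd]
  refine le_totalDegree_of_mem_idealOfVars_pow ?_ hf0
  rw [pow_mul]
  exact Ideal.pow_right_mono hI.le_idealOfVars_pow_alphaDeg t (hJI hf)

lemma projPointIdeal_isHomogeneous {N : ℕ} (p : Fin N → K) :
    (projPointIdeal K p).IsHomogeneous (homogeneousSubmodule (Fin N) K) :=
  Ideal.homogeneous_span _ _ fun _ hf => hf.1

lemma iInf_projPointIdeal_pow_isHomogeneous {N : ℕ} {ι : Type*} (p : ι → Fin N → K) (k : ℕ) :
    (⨅ i, projPointIdeal K (p i) ^ k).IsHomogeneous (homogeneousSubmodule (Fin N) K) :=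
  Ideal.IsHomogeneous.iInf fun i => (projPointIdeal_isHomogeneous (p i)).pow_of_homogeneousSubmodule k

end AlphaDeg

lemma Ideal.iInf_pow_ne_bot {R ι : Type*} [CommRing R] [IsDomain R] [Fintype ι] {I : ι → Ideal R}
    (hI : ∀ i, I i ≠ ⊥) (k : ℕ) : ⨅ i, I i ^ k ≠ ⊥ := by
  choose f hf hf0 using fun i => Submodule.exists_mem_ne_zero_of_ne_bot (hI i)
  refine Submodule.ne_bot_iff _ |>.mpr ⟨∏ i, f i ^ k, ?_, ?_⟩
  · exact (Submodule.mem_iInf _).mpr fun i => Ideal.mem_of_dvd _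
      (Finset.dvd_prod_of_mem (fun i => f i ^ k) (Finset.mem_univ i))
      (Ideal.pow_mem_pow (hf i) k)
  · exact Finset.prod_ne_zero_iff.mpr fun i _ => pow_ne_zero k (hf0 i)

lemma Ideal.iInf_pow_mul_iInf_pow_le {R ι : Type*} [CommRing R] (I : ι → Ideal R) (a b : ℕ) :
    (⨅ i, I i ^ a) * (⨅ i, I i ^ b) ≤ ⨅ i, I i ^ (a + b) :=
  le_iInf fun i => by
    rw [pow_add]
    exact Ideal.mul_mono (iInf_le _ i) (iInf_le _ i)

/-- for the radical ideal `I` of distinct points of `ℙ^n`, if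
`I^{((m−1+n)t)} ⊆ (I^{(m)})^t` for all `t ≥ 1`, then `α(I^{(m)})/(n+m−1) ≤ γ(I)`, where
`γ(I) = lim_k α(I^{(k)})/k` (which exists). -/
theorem stmt_17 {K : Type*} [Field K] [IsAlgClosed K]
    (n s : ℕ) (hs : 1 ≤ s)
    (p : Fin s → (Fin (n + 1) → K)) (hp0 : ∀ i, p i ≠ 0)
    (hpdist : ∀ i j, i ≠ j → ∀ c : K, p i ≠ c • p j)
    (m : ℕ) (hm : 1 ≤ m)
    (hcont : ∀ t : ℕ, 1 ≤ t →
      (⨅ i, (projPointIdeal K (p i)) ^ ((m - 1 + n) * t))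
        ≤ (⨅ i, (projPointIdeal K (p i)) ^ m) ^ t) :
    ∃ γ : ℝ,
      Filter.Tendsto
        (fun k : ℕ => (alphaDeg (⨅ i, (projPointIdeal K (p i)) ^ k) : ℝ) / k)
        Filter.atTop (nhds γ) ∧
      (alphaDeg (⨅ i, (projPointIdeal K (p i)) ^ m) : ℝ) / ((n + m - 1 : ℕ) : ℝ) ≤ γ := by
  by_cases hbot : ∃ i, projPointIdeal K (p i) = ⊥
  · obtain ⟨i, hi⟩ := hbot
    have hzero : ∀ k : ℕ, k ≠ 0 → alphaDeg (⨅ i, (projPointIdeal K (p i)) ^ k) = 0 := by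
      intro k hk
      have h : ⨅ i, (projPointIdeal K (p i)) ^ k = ⊥ := by
        refine eq_bot_iff.mpr ((iInf_le _ i).trans ?_)
        rw [hi, ← Ideal.zero_eq_bot, zero_pow hk]
      rw [h, alphaDeg_bot]
    refine ⟨0, tendsto_const_nhds.congr fun k => ?_, ?_⟩
    · rcases eq_or_ne k 0 with rfl | hk
      · simp
      · simp [hzero k hk]
    · simp [hzero m (by omega)]
  push Not at hbot
  have hne := Ideal.iInf_pow_ne_bot hbot
  have hsub : Subadditive fun k : ℕ =>
      (alphaDeg (⨅ i, (projPointIdeal K (p i)) ^ k) : ℝ) := by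
    intro a b
    have h := (alphaDeg_anti (mul_ne_zero (hne a) (hne b))
      (Ideal.iInf_pow_mul_iInf_pow_le _ a b)).trans (alphaDeg_mul_le (hne a) (hne b))
    dsimp only
    exact_mod_cast h
  have hlim := hsub.tendsto_lim
    ⟨0, by rintro _ ⟨k, rfl⟩; positivity⟩
  refine ⟨hsub.lim, hlim, ?_⟩
  rcases Nat.eq_zero_or_pos (n + m - 1) with hN | hN
  · rw [hN, Nat.cast_zero, div_zero]
    exact ge_of_tendsto' hlim fun k => by positivity
  have hmul : Tendsto (fun t : ℕ => (n + m - 1) * t) atTop atTop :=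
    tendsto_id.const_mul_atTop' hN
  refine ge_of_tendsto (hlim.comp hmul) ?_
  filter_upwards [eventually_ge_atTop 1] with t ht
  have hct := hcont t ht
  rw [show m - 1 + n = n + m - 1 by omega] at hct
  have hle := (iInf_projPointIdeal_pow_isHomogeneous p m).alphaDeg_mul_le_of_le_pow (hne _) hct
  have hNR : (0 : ℝ) < ((n + m - 1 : ℕ) : ℝ) := by exact_mod_cast hN
  have htR : (0 : ℝ) < (t : ℝ) := by exact_mod_cast ht
  simp only [Function.comp_apply]
  rw [Nat.cast_mul, div_le_div_iff₀ hNR (mul_pos hNR htR)]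
  have hleR : (alphaDeg (⨅ i, (projPointIdeal K (p i)) ^ m) : ℝ) * t ≤
      alphaDeg (⨅ i, (projPointIdeal K (p i)) ^ ((n + m - 1) * t)) := by exact_mod_cast hle
  nlinarith
end
end
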